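/- Let q = p^n for some positive integer n, let R, S be integers with 0 < R, S < q, and set m = min(R,S), e = R+S-q, f = S-R. Then: (1) lambda(R,S)_i = q for 1 <= i <= max(e,0), and if max(e,0) < m then lambda(R,S)_{max(e,0)+1} < q; (2) lambda(q-R,q-S)_i = q for 1 <= i <= max(-e,0), and lambda(q-R,q-S)_{max(-e,0)+i} = lambda(R,S)_{max(e,0)+i} for 1 <= i <= m-max(e,0); (3) lambda(q-R,S)_i = q for 1 <= i <= max(f,0), and lambda(q-R,S)_{max(f,0)+i} = q - lambda(R,S)_{m+1-i} for 1 <= i <= m-max(e,0); (4) lambda(R,q-S)_i = q for 1 <= i <= max(-f,0), and lambda(R,q-S)_{max(-f,0)+i} = q - lambda(R,S)_{m+1-i} for 1 <= i <= m-max(e,0). -/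

import Mathlib

open scoped BigOperators

noncomputable section

/-- The basis vector `v_{a,b}` of `M(r,s)` (1-indexed), read as `0` when
`a` or `b` is out of range. -/
def vv (F : Type*) [Field F] (r s : ℕ) (a b : ℤ) : Matrix (Fin r) (Fin s) F :=
  Matrix.of fun i j => if (i : ℤ) + 1 = a ∧ (j : ℤ) + 1 = b then 1 else 0

/-- The linear endomorphism `T` of `M(r,s)` with `T(v_{i,j}) = v_{i-1,j} + v_{i,j-1}`
(out-of-range symbols read as `0`); it models the action of `g - 1`. -/
def TT (F : Type*) [Field F] (r s : ℕ) :
    Matrix (Fin r) (Fin s) F →ₗ[F] Matrix (Fin r) (Fin s) F where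
  toFun A := Matrix.of fun i j =>
    (if h : (i : ℕ) + 1 < r then A ⟨(i : ℕ) + 1, h⟩ j else 0) +
    (if h : (j : ℕ) + 1 < s then A i ⟨(j : ℕ) + 1, h⟩ else 0)
  map_add' A B := by
    ext i j
    simp only [Matrix.of_apply, Matrix.add_apply]
    split_ifs <;> abel
  map_smul' c A := by
    ext i j
    simp only [Matrix.of_apply, Matrix.smul_apply, RingHom.id_apply, smul_eq_mul]
    split_ifs <;> ring

/-- `x_m = ∑_{j=1}^m (-1)^{j-1} v_{j, m+1-j}` (the empty sum if `m ≤ 0`). -/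
def xx (F : Type*) [Field F] (r s : ℕ) (m : ℤ) : Matrix (Fin r) (Fin s) F :=
  ∑ j ∈ Finset.range m.toNat, ((-1 : F) ^ j) • vv F r s ((j : ℤ) + 1) (m - j)

/-- The subspace `D_d` of `M(r,s)`, spanned by the `v_{i,j}` with `i + j = d + 1`. -/
def Dd (F : Type*) [Field F] (r s : ℕ) (d : ℕ) :
    Submodule F (Matrix (Fin r) (Fin s) F) :=
  Submodule.span F { A | ∃ a b : ℕ, 1 ≤ a ∧ a ≤ r ∧ 1 ≤ b ∧ b ≤ s ∧
    a + b = d + 1 ∧ A = vv F r s (a : ℤ) (b : ℤ) }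

/-- Binomial coefficient `C(a,b)` as an element of `F`, with the convention that
it is `0` when `b < 0` or `b > a`. -/
def binF (F : Type*) [Field F] (a b : ℤ) : F :=
  if 0 ≤ b ∧ b ≤ a then (Nat.choose a.toNat b.toNat : F) else 0

/-- `lam` (restricted to indices `1,…,min r s`) is the Jordan type of the nilpotent
operator `T` on `M(r,s)`: a nonincreasing list of `min r s` positive integers such that
for each `m ≥ 1` the number of parts `≥ m` is `rank T^{m-1} - rank T^m`. -/
def IsJordanType (F : Type*) [Field F] (r s : ℕ) (lam : ℕ → ℕ) : Prop :=
  (∀ l, 1 ≤ l → l ≤ min r s → 0 < lam l) ∧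
  (∀ l l', 1 ≤ l → l ≤ l' → l' ≤ min r s → lam l' ≤ lam l) ∧
  ∀ m, 1 ≤ m →
    ((Finset.Icc 1 (min r s)).filter fun l => m ≤ lam l).card =
      Module.finrank F ↥(LinearMap.range ((TT F r s) ^ (m - 1))) -
      Module.finrank F ↥(LinearMap.range ((TT F r s) ^ m))

/-- The shift of matrix rows: `(i, j) ↦ A (i + 1, j)`, read as `0` out of range. -/
def rowShift (F : Type*) [Field F] (r s : ℕ) : Module.End F (Matrix (Fin r) (Fin s) F) where
  toFun A := Matrix.of fun i j => if h : (i : ℕ) + 1 < r then A ⟨(i : ℕ) + 1, h⟩ j else 0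
  map_add' A B := by
    ext i j
    simp only [Matrix.of_apply, Matrix.add_apply]
    split_ifs <;> simp
  map_smul' c A := by
    ext i j
    simp only [Matrix.of_apply, Matrix.smul_apply, RingHom.id_apply, smul_eq_mul]
    split_ifs <;> simp

/-- The shift of matrix columns: `(i, j) ↦ A (i, j + 1)`, read as `0` out of range. -/
def colShift (F : Type*) [Field F] (r s : ℕ) : Module.End F (Matrix (Fin r) (Fin s) F) where
  toFun A := Matrix.of fun i j => if h : (j : ℕ) + 1 < s then A i ⟨(j : ℕ) + 1, h⟩ else 0
  map_add' A B := by
    ext i j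
    simp only [Matrix.of_apply, Matrix.add_apply]
    split_ifs <;> simp
  map_smul' c A := by
    ext i j
    simp only [Matrix.of_apply, Matrix.smul_apply, RingHom.id_apply, smul_eq_mul]
    split_ifs <;> simp

section Shifts

variable {F : Type*} [Field F] {r s : ℕ}

theorem rowShift_apply (A : Matrix (Fin r) (Fin s) F) (i : Fin r) (j : Fin s) :
    rowShift F r s A i j = if h : (i : ℕ) + 1 < r then A ⟨(i : ℕ) + 1, h⟩ j else 0 := rfl

theorem colShift_apply (A : Matrix (Fin r) (Fin s) F) (i : Fin r) (j : Fin s) :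
    colShift F r s A i j = if h : (j : ℕ) + 1 < s then A i ⟨(j : ℕ) + 1, h⟩ else 0 := rfl

theorem TT_apply (A : Matrix (Fin r) (Fin s) F) (i : Fin r) (j : Fin s) :
    TT F r s A i j = (if h : (i : ℕ) + 1 < r then A ⟨(i : ℕ) + 1, h⟩ j else 0) +
      (if h : (j : ℕ) + 1 < s then A i ⟨(j : ℕ) + 1, h⟩ else 0) := rfl

theorem TT_eq_rowShift_add_colShift : TT F r s = rowShift F r s + colShift F r s := rfl

theorem finrank_range_TT_pow_zero :
    Module.finrank F (LinearMap.range (TT F r s ^ 0)) = r * s := by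
  rw [pow_zero, Module.End.one_eq_id, LinearMap.range_id, finrank_top, Module.finrank_matrix]
  simp

theorem commute_rowShift_colShift : Commute (rowShift F r s) (colShift F r s) := by
  refine LinearMap.ext fun A => ?_
  ext i j
  simp only [Module.End.mul_apply, rowShift_apply, colShift_apply]
  split_ifs <;> rfl

theorem rowShift_pow_apply (k : ℕ) (A : Matrix (Fin r) (Fin s) F) (i : Fin r) (j : Fin s) :
    (rowShift F r s ^ k) A i j = if h : (i : ℕ) + k < r then A ⟨(i : ℕ) + k, h⟩ j else 0 := by
  induction k generalizing A with
  | zero => simp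
  | succ k ih =>
    rw [pow_succ, Module.End.mul_apply, ih]
    simp only [rowShift_apply]
    split_ifs <;> first | rfl | omega

theorem colShift_pow_apply (k : ℕ) (A : Matrix (Fin r) (Fin s) F) (i : Fin r) (j : Fin s) :
    (colShift F r s ^ k) A i j = if h : (j : ℕ) + k < s then A i ⟨(j : ℕ) + k, h⟩ else 0 := by
  induction k generalizing A with
  | zero => simp
  | succ k ih =>
    rw [pow_succ, Module.End.mul_apply, ih]
    simp only [colShift_apply]
    split_ifs <;> first | rfl | omega

theorem rowShift_pow_eq_zero {k : ℕ} (hk : r ≤ k) : rowShift F r s ^ k = 0 := by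
  refine LinearMap.ext fun A => ?_
  ext i j
  rw [rowShift_pow_apply, dif_neg (by omega)]
  rfl

theorem colShift_pow_eq_zero {k : ℕ} (hk : s ≤ k) : colShift F r s ^ k = 0 := by
  refine LinearMap.ext fun A => ?_
  ext i j
  rw [colShift_pow_apply, dif_neg (by omega)]
  rfl

/-- In characteristic `p`, the operator `T` on `M(r,s)` is killed by any power `p ^ n ≥ r, s`. -/
theorem TT_pow_prime_pow_eq_zero {p n : ℕ} (hp : p.Prime) [CharP F p] (hr0 : 0 < r) (hs0 : 0 < s)
    (hr : r ≤ p ^ n) (hs : s ≤ p ^ n) : TT F r s ^ p ^ n = 0 := by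
  have : Fact p.Prime := ⟨hp⟩
  have : Nonempty (Fin r) := ⟨⟨0, hr0⟩⟩
  have : Nonempty (Fin s) := ⟨⟨0, hs0⟩⟩
  have : CharP (Module.End F (Matrix (Fin r) (Fin s) F)) p :=
    charP_of_injective_algebraMap
      (FaithfulSMul.algebraMap_injective F (Module.End F (Matrix (Fin r) (Fin s) F))) p
  rw [TT_eq_rowShift_add_colShift, add_pow_char_pow_of_commute p n commute_rowShift_colShift,
    rowShift_pow_eq_zero hr, colShift_pow_eq_zero hs, add_zero]

/-- A matrix killed by `T` is determined by its first row. -/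
theorem finrank_ker_TT_le : Module.finrank F (LinearMap.ker (TT F r s)) ≤ s := by
  rcases Nat.eq_zero_or_pos r with rfl | hr
  · rw [Module.finrank_zero_of_subsingleton]
    exact Nat.zero_le s
  let f : LinearMap.ker (TT F r s) →ₗ[F] (Fin s → F) :=
    (LinearMap.proj (R := F) (φ := fun _ : Fin r => Fin s → F) ⟨0, hr⟩ :
      (Fin r → Fin s → F) →ₗ[F] (Fin s → F)) ∘ₗ (LinearMap.ker (TT F r s)).subtype
  have hf : Function.Injective f := by
    rw [injective_iff_map_eq_zero]
    rintro ⟨A, hA⟩ h0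
    have hrow : ∀ j, A ⟨0, hr⟩ j = 0 := fun j => congrFun h0 j
    have key : ∀ k (hk : k < r) j, A ⟨k, hk⟩ j = 0 := by
      intro k
      induction k with
      | zero => exact fun _ => hrow
      | succ k ih =>
        intro hk j
        have h1 : TT F r s A ⟨k, by omega⟩ j = 0 := by
          rw [LinearMap.mem_ker.1 hA]
          rfl
        rw [TT_apply, dif_pos hk] at h1
        split_ifs at h1 with h2
        · rwa [ih, add_zero] at h1
        · rwa [add_zero] at h1
    apply Subtype.ext
    ext i j
    exact key i i.2 j
  simpa using LinearMap.finrank_le_finrank_of_injective hf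

end Shifts

section LinearAlgebra

open Module LinearMap

variable {K : Type*} [Field K]

theorem finrank_map_add_finrank_inf_ker {V W : Type*} [AddCommGroup V] [Module K V]
    [FiniteDimensional K V] [AddCommGroup W] [Module K W] (f : V →ₗ[K] W) (p : Submodule K V) :
    finrank K (p.map f) + finrank K (p ⊓ ker f : Submodule K V) = finrank K p := by
  have h := (f.domRestrict p).finrank_range_add_finrank_ker
  rw [range_domRestrict, ker_domRestrict] at h
  rw [← h, ← Submodule.map_comap_subtype, Submodule.finrank_map_subtype_eq]

theorem finrank_range_pow_le_add {V : Type*} [AddCommGroup V] [Module K V]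
    [FiniteDimensional K V] (t : End K V) (m d : ℕ) :
    finrank K (range (t ^ m)) ≤ finrank K (range (t ^ (m + d))) + d * finrank K (ker t) := by
  induction d with
  | zero => simp
  | succ d ih =>
    have h1 := finrank_map_add_finrank_inf_ker t (range (t ^ (m + d)))
    have h2 : (range (t ^ (m + d))).map t = range (t ^ (m + (d + 1))) := by
      rw [← add_assoc, pow_succ', Module.End.mul_eq_comp, range_comp]
    have h3 : finrank K (range (t ^ (m + d)) ⊓ ker t : Submodule K V) ≤ finrank K (ker t) :=
      Submodule.finrank_mono inf_le_right
    rw [h2] at h1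
    rw [add_mul]
    omega

/-- A nilpotent operator with `t ^ q = 0` and `dim ker t ≤ s` on a space of dimension `q * s`
has all its Jordan blocks of size `q`. -/
theorem finrank_range_pow_of_finrank_ker_le {V : Type*} [AddCommGroup V] [Module K V]
    [FiniteDimensional K V] {t : End K V} {q s : ℕ} (hq : t ^ q = 0)
    (hs : finrank K (ker t) ≤ s) (hV : finrank K V = q * s) {m : ℕ} (hm : m ≤ q) :
    finrank K (range (t ^ m)) = (q - m) * s := by
  have h1 := finrank_range_pow_le_add t m (q - m)
  have h2 := finrank_range_pow_le_add t 0 m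
  rw [Nat.add_sub_cancel' hm, hq, range_zero, finrank_bot, zero_add] at h1
  rw [pow_zero, Module.End.one_eq_id, range_id, finrank_top, zero_add, hV] at h2
  have h3 := Nat.mul_le_mul_left (q - m) hs
  have h4 := Nat.mul_le_mul_left m hs
  have h5 : q * s = (q - m) * s + m * s := by rw [← add_mul, Nat.sub_add_cancel hm]
  omega

theorem range_pow_eq_ker_pow {V : Type*} [AddCommGroup V] [Module K V]
    [FiniteDimensional K V] {t : End K V} {q s : ℕ} (hq : t ^ q = 0)
    (hs : finrank K (ker t) ≤ s) (hV : finrank K V = q * s) {m : ℕ} (hm : m ≤ q) :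
    range (t ^ m) = ker (t ^ (q - m)) := by
  refine Submodule.eq_of_le_of_finrank_eq ?_ ?_
  · rintro _ ⟨x, rfl⟩
    rw [mem_ker, ← Module.End.mul_apply, ← pow_add, Nat.sub_add_cancel hm, hq, LinearMap.zero_apply]
  · have h1 := finrank_range_pow_of_finrank_ker_le hq hs hV hm
    have h2 := finrank_range_pow_of_finrank_ker_le hq hs hV (Nat.sub_le q m)
    have h3 := (t ^ (q - m)).finrank_range_add_finrank_ker
    have h5 : q * s = (q - m) * s + m * s := by rw [← add_mul, Nat.sub_add_cancel hm]
    rw [Nat.sub_sub_self hm] at h2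
    omega

/-- Ranks of powers on a quotient of a free `K[t]/(t ^ q)`-module in terms of those on the
kernel. -/
theorem finrank_range_pow_of_exact {U V W : Type*} [AddCommGroup U] [Module K U]
    [FiniteDimensional K U] [AddCommGroup V] [Module K V] [FiniteDimensional K V]
    [AddCommGroup W] [Module K W] {t : End K U} {u : End K V} {w : End K W}
    {ι : U →ₗ[K] V} {π : V →ₗ[K] W} (hι : Function.Injective ι) (hπ : Function.Surjective π)
    (hex : range ι = ker π) (htu : ι ∘ₗ t = u ∘ₗ ι) (huw : π ∘ₗ u = w ∘ₗ π)
    {q s : ℕ} (hq : u ^ q = 0) (hs : finrank K (ker u) ≤ s) (hV : finrank K V = q * s)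
    {m : ℕ} (hm : m ≤ q) :
    finrank K (range (w ^ m)) + finrank K U = (q - m) * s + finrank K (range (t ^ (q - m))) := by
  have htu' : ∀ k x, ι ((t ^ k) x) = (u ^ k) (ι x) := by
    intro k x
    exact (LinearMap.congr_fun (Module.End.commute_pow_left_of_commute htu.symm k) x).symm
  have huw' : ∀ k x, π ((u ^ k) x) = (w ^ k) (π x) := by
    intro k x
    exact (LinearMap.congr_fun (Module.End.commute_pow_left_of_commute huw.symm k) x).symm
  have h1 : (range (u ^ m)).map π = range (w ^ m) := by
    ext y
    constructor
    · rintro ⟨_, ⟨x, rfl⟩, rfl⟩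
      exact ⟨π x, (huw' m x).symm⟩
    · rintro ⟨x, rfl⟩
      obtain ⟨z, rfl⟩ := hπ x
      exact ⟨_, ⟨z, rfl⟩, huw' m z⟩
  have h2 : range (u ^ m) ⊓ ker π = (ker (t ^ (q - m))).map ι := by
    rw [range_pow_eq_ker_pow hq hs hV hm, ← hex]
    ext y
    constructor
    · rintro ⟨hy, x, rfl⟩
      refine ⟨x, hι ?_, rfl⟩
      rw [htu', map_zero]
      exact hy
    · rintro ⟨x, hx, rfl⟩
      refine ⟨?_, x, rfl⟩
      have hx' : (t ^ (q - m)) x = 0 := hx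
      rw [SetLike.mem_coe, mem_ker, ← htu', hx', map_zero]
  have h3 := finrank_map_add_finrank_inf_ker π (range (u ^ m))
  rw [h1, h2, ← (Submodule.equivMapOfInjective ι hι _).finrank_eq,
    finrank_range_pow_of_finrank_ker_le hq hs hV hm] at h3
  have h4 := (t ^ (q - m)).finrank_range_add_finrank_ker
  omega

end LinearAlgebra

section Matrices

variable (F : Type*) [Field F]

/-- The inclusion `M(r,s) → M(r',s)` that adds zero rows. -/
def extendRows (r r' s : ℕ) : Matrix (Fin r) (Fin s) F →ₗ[F] Matrix (Fin r') (Fin s) F where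
  toFun A := Matrix.of fun i j => if h : (i : ℕ) < r then A ⟨i, h⟩ j else 0
  map_add' A B := by
    ext i j
    simp only [Matrix.of_apply, Matrix.add_apply]
    split_ifs <;> simp
  map_smul' c A := by
    ext i j
    simp only [Matrix.of_apply, Matrix.smul_apply, RingHom.id_apply, smul_eq_mul]
    split_ifs <;> simp

/-- The projection `M(q,s) → M(q-r,s)` that drops the first `r` rows. -/
def dropRows (q r s : ℕ) : Matrix (Fin q) (Fin s) F →ₗ[F] Matrix (Fin (q - r)) (Fin s) F where
  toFun A := Matrix.of fun i j => A ⟨(i : ℕ) + r, by omega⟩ j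
  map_add' _ _ := rfl
  map_smul' _ _ := rfl

variable {F}

theorem extendRows_apply {r r' s : ℕ} (A : Matrix (Fin r) (Fin s) F) (i : Fin r') (j : Fin s) :
    extendRows F r r' s A i j = if h : (i : ℕ) < r then A ⟨i, h⟩ j else 0 := rfl

theorem dropRows_apply {q r s : ℕ} (A : Matrix (Fin q) (Fin s) F) (i : Fin (q - r)) (j : Fin s) :
    dropRows F q r s A i j = A ⟨(i : ℕ) + r, by omega⟩ j := rfl

theorem extendRows_injective {r r' s : ℕ} (h : r ≤ r') :
    Function.Injective (extendRows F r r' s) := by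
  intro A B hAB
  ext i j
  have := congrFun (congrFun hAB ⟨i, by omega⟩) j
  simpa [extendRows_apply] using this

theorem dropRows_surjective {q r s : ℕ} : Function.Surjective (dropRows F q r s) := by
  intro B
  refine ⟨Matrix.of fun i j => if h : r ≤ (i : ℕ) then B ⟨(i : ℕ) - r, by omega⟩ j else 0, ?_⟩
  ext i j
  simp [dropRows_apply]

theorem range_extendRows_eq_ker_dropRows {q r s : ℕ} (h : r ≤ q) :
    LinearMap.range (extendRows F r q s) = LinearMap.ker (dropRows F q r s) := by
  ext A
  constructor
  · rintro ⟨B, rfl⟩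
    rw [LinearMap.mem_ker]
    ext i j
    rw [dropRows_apply, extendRows_apply, dif_neg (by simp)]
    rfl
  · intro hA
    refine ⟨Matrix.of fun i j => A ⟨i, by omega⟩ j, ?_⟩
    ext i j
    rw [extendRows_apply]
    split_ifs with hi
    · rfl
    · have h1 : dropRows F q r s A ⟨(i : ℕ) - r, by omega⟩ j = 0 := by
        rw [LinearMap.mem_ker.1 hA]
        rfl
      rw [dropRows_apply] at h1
      simp only [Nat.sub_add_cancel (not_lt.1 hi)] at h1
      exact h1.symm

theorem extendRows_comp_TT {r r' s : ℕ} (h : r ≤ r') :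
    extendRows F r r' s ∘ₗ TT F r s = TT F r' s ∘ₗ extendRows F r r' s := by
  refine LinearMap.ext fun A => ?_
  ext i j
  simp only [LinearMap.comp_apply, TT_apply, extendRows_apply]
  split_ifs <;> first | rfl | omega | simp

theorem dropRows_comp_TT {q r s : ℕ} :
    dropRows F q r s ∘ₗ TT F q s = TT F (q - r) s ∘ₗ dropRows F q r s := by
  refine LinearMap.ext fun A => ?_
  ext i j
  simp only [LinearMap.comp_apply, TT_apply, dropRows_apply]
  simp only [Nat.lt_sub_iff_add_lt, Nat.add_right_comm]

theorem finrank_range_TT_pow_swap (r s m : ℕ) :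
    Module.finrank F (LinearMap.range (TT F r s ^ m)) =
      Module.finrank F (LinearMap.range (TT F s r ^ m)) := by
  let e := Matrix.transposeLinearEquiv (Fin r) (Fin s) F F
  have he : (TT F s r) ∘ₗ e.toLinearMap = e.toLinearMap ∘ₗ TT F r s := by
    refine LinearMap.ext fun A => ?_
    ext i j
    simp only [LinearMap.comp_apply, TT_apply]
    exact add_comm _ _
  have hpow : ∀ A, (TT F s r ^ m) (e A) = e ((TT F r s ^ m) A) := fun A =>
    LinearMap.congr_fun (Module.End.commute_pow_left_of_commute he m) A
  have h : (LinearMap.range (TT F r s ^ m)).map e.toLinearMap =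
      LinearMap.range (TT F s r ^ m) := by
    ext y
    constructor
    · rintro ⟨_, ⟨x, rfl⟩, rfl⟩
      exact ⟨e x, hpow x⟩
    · rintro ⟨x, rfl⟩
      obtain ⟨z, rfl⟩ := e.surjective x
      exact ⟨_, ⟨z, rfl⟩, (hpow z).symm⟩
  rw [← h]
  exact (LinearEquiv.finrank_map_eq e _).symm

theorem finrank_range_TT_pow_reflect {p n : ℕ} (hp : p.Prime) [CharP F p] {r s m : ℕ}
    (hr : r ≤ p ^ n) (hs0 : 0 < s) (hs : s ≤ p ^ n) (hm : m ≤ p ^ n) :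
    Module.finrank F (LinearMap.range (TT F (p ^ n - r) s ^ m)) + r * s =
      (p ^ n - m) * s + Module.finrank F (LinearMap.range (TT F r s ^ (p ^ n - m))) := by
  have h := finrank_range_pow_of_exact (extendRows_injective hr) dropRows_surjective
    (range_extendRows_eq_ker_dropRows (F := F) (s := s) hr) (extendRows_comp_TT hr)
    dropRows_comp_TT (TT_pow_prime_pow_eq_zero hp (pow_pos hp.pos n) hs0 le_rfl hs)
    finrank_ker_TT_le (by simp [Module.finrank_matrix]) hm
  simpa [Module.finrank_matrix] using h

end Matrices

section JordanType

variable {F : Type*} [Field F]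

theorem IsJordanType.swap {r s : ℕ} {lam : ℕ → ℕ} (h : IsJordanType F r s lam) :
    IsJordanType F s r lam := by
  obtain ⟨h1, h2, h3⟩ := h
  rw [min_comm] at h1 h2 h3
  refine ⟨h1, h2, fun m hm => ?_⟩
  rw [h3 m hm, finrank_range_TT_pow_swap r s, finrank_range_TT_pow_swap r s]

theorem IsJordanType.le_iff {r s : ℕ} {lam : ℕ → ℕ} (h : IsJordanType F r s lam) {l m : ℕ}
    (hl : 1 ≤ l) (hl' : l ≤ min r s) (hm : 1 ≤ m) :
    m ≤ lam l ↔ l ≤ Module.finrank F (LinearMap.range (TT F r s ^ (m - 1))) -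
      Module.finrank F (LinearMap.range (TT F r s ^ m)) := by
  obtain ⟨-, h2, h3⟩ := h
  rw [← h3 m hm]
  constructor
  · intro hml
    have hsub : Finset.Icc 1 l ⊆ (Finset.Icc 1 (min r s)).filter fun l => m ≤ lam l := by
      intro k hk
      rw [Finset.mem_Icc] at hk
      rw [Finset.mem_filter, Finset.mem_Icc]
      exact ⟨⟨hk.1, hk.2.trans hl'⟩, hml.trans (h2 k l hk.1 hk.2 hl')⟩
    simpa using Finset.card_le_card hsub
  · intro hcard
    by_contra hml
    have hsub : ((Finset.Icc 1 (min r s)).filter fun l => m ≤ lam l) ⊆ Finset.Icc 1 (l - 1) := by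
      intro k hk
      rw [Finset.mem_filter, Finset.mem_Icc] at hk
      rw [Finset.mem_Icc]
      refine ⟨hk.1.1, ?_⟩
      by_contra hkl
      exact hml (hk.2.trans (h2 l k hl (by omega) hk.1.2))
    have := Finset.card_le_card hsub
    rw [Nat.card_Icc] at this
    omega

theorem IsJordanType.sub_eq_min {r s : ℕ} {lam : ℕ → ℕ} (h : IsJordanType F r s lam) :
    Module.finrank F (LinearMap.range (TT F r s ^ 0)) -
      Module.finrank F (LinearMap.range (TT F r s ^ 1)) = min r s := by
  obtain ⟨h1, -, h3⟩ := h
  rw [← h3 1 le_rfl, Finset.filter_true_of_mem, Nat.card_Icc, Nat.add_sub_cancel]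
  intro l hl
  rw [Finset.mem_Icc] at hl
  exact h1 l hl.1 hl.2

theorem finrank_range_pow_antitone {K V : Type*} [Field K] [AddCommGroup V] [Module K V]
    [FiniteDimensional K V] (t : Module.End K V) {a b : ℕ} (hab : a ≤ b) :
    Module.finrank K (LinearMap.range (t ^ b)) ≤ Module.finrank K (LinearMap.range (t ^ a)) := by
  obtain ⟨c, rfl⟩ := Nat.exists_eq_add_of_le hab
  rw [pow_add, Module.End.mul_eq_comp]
  exact Submodule.finrank_mono (LinearMap.range_comp_le_range _ _)

/-- The parts of size `p ^ n` in the Jordan type for `(p ^ n - r, s)`, and the remaining parts in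
terms of those for `(r, s)`. -/
theorem IsJordanType.reflect {p n : ℕ} (hp : p.Prime) [CharP F p] {r s : ℕ}
    (hr : r < p ^ n) (hs0 : 0 < s) (hs : s < p ^ n) {lam mu : ℕ → ℕ}
    (hlam : IsJordanType F r s lam) (hmu : IsJordanType F (p ^ n - r) s mu) :
    (∀ i, 1 ≤ i → i ≤ s - r → mu i = p ^ n) ∧
      ∀ i, 1 ≤ i → i ≤ min r s - (r + s - p ^ n) →
        mu (s - r + i) + lam (min r s + 1 - i) = p ^ n := by
  have hrefl := fun m => finrank_range_TT_pow_reflect (F := F) (m := m) hp hr.le hs0 hs.le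
  have hlam' := fun l m => hlam.le_iff (l := l) (m := m)
  have hmu' := fun l m => hmu.le_iff (l := l) (m := m)
  have hmin := hlam.sub_eq_min
  have hpos := hlam.1
  have hpos' := hmu.1
  have hanti := fun a => finrank_range_pow_antitone (TT F r s) (Nat.le_add_right a 1)
  have hanti' := fun a => finrank_range_pow_antitone (TT F (p ^ n - r) s) (Nat.le_add_right a 1)
  have hz : Module.finrank F (LinearMap.range (TT F r s ^ 0)) = r * s :=
    finrank_range_TT_pow_zero
  generalize p ^ n = q at *
  set A : ℕ → ℕ := fun m => Module.finrank F (LinearMap.range (TT F r s ^ m))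
  set B : ℕ → ℕ := fun m => Module.finrank F (LinearMap.range (TT F (q - r) s ^ m))
  change ∀ m, m ≤ q → B m + r * s = (q - m) * s + A (q - m) at hrefl
  change ∀ l m, 1 ≤ l → l ≤ min r s → 1 ≤ m → (m ≤ lam l ↔ l ≤ A (m - 1) - A m) at hlam'
  change ∀ l m, 1 ≤ l → l ≤ min (q - r) s → 1 ≤ m → (m ≤ mu l ↔ l ≤ B (m - 1) - B m) at hmu'
  change A 0 - A 1 = min r s at hmin
  change ∀ a, A (a + 1) ≤ A a at hanti
  change ∀ a, B (a + 1) ≤ B a at hanti'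
  change A 0 = r * s at hz
  have hAq : A q = 0 := by
    have h0 : B 0 = (q - r) * s := finrank_range_TT_pow_zero
    have h1 := hrefl 0 (Nat.zero_le q)
    rw [h0, Nat.sub_zero, ← add_mul, Nat.sub_add_cancel hr.le] at h1
    omega
  have hBq : B q = 0 := by
    have := hrefl q le_rfl
    simp only [Nat.sub_self, zero_mul] at this
    omega
  have hlam_le : ∀ l, 1 ≤ l → l ≤ min r s → lam l ≤ q := by
    intro l h1 h2
    have := hlam' l (q + 1) h1 h2 (by omega)
    rw [Nat.add_sub_cancel, hAq] at this
    omega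
  have hmu_le : ∀ l, 1 ≤ l → l ≤ min (q - r) s → mu l ≤ q := by
    intro l h1 h2
    have := hmu' l (q + 1) h1 h2 (by omega)
    rw [Nat.add_sub_cancel, hBq] at this
    omega
  have hdual : ∀ m, 1 ≤ m → m ≤ q → B (m - 1) - B m + (A (q - m) - A (q - m + 1)) = s := by
    intro m h1 h2
    have e1 := hrefl m h2
    have e2 := hrefl (m - 1) (by omega)
    have e3 : q - (m - 1) = q - m + 1 := by omega
    rw [e3, add_mul, one_mul] at e2
    have e4 := hanti (q - m)
    have e5 := hanti' (m - 1)
    rw [Nat.sub_add_cancel h1] at e5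
    omega
  constructor
  · intro i h1 h2
    have h3 : i ≤ min (q - r) s := by omega
    refine le_antisymm (hmu_le i h1 h3) ((hmu' i q h1 h3 (by omega)).2 ?_)
    have := hdual q (by omega) le_rfl
    rw [Nat.sub_self, zero_add, hmin] at this
    omega
  · intro i h1 h2
    have hl : s - r + i ≤ min (q - r) s := by omega
    have hl1 : min r s + 1 - i ≤ min r s := by omega
    have key : ∀ m, 1 ≤ m → m ≤ q →
        (m ≤ mu (s - r + i) ↔ ¬ (q - m + 1 ≤ lam (min r s + 1 - i))) := by
      intro m hm1 hm2
      rw [hmu' _ m (by omega) hl hm1, hlam' _ _ (by omega) hl1 (by omega), Nat.add_sub_cancel]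
      have := hdual m hm1 hm2
      omega
    have b1 := hmu_le _ (by omega) hl
    have b2 := hlam_le _ (by omega) hl1
    have b3 := hpos' _ (by omega) hl
    have k1 := key _ b3 b1
    rcases Nat.lt_or_ge (lam (min r s + 1 - i)) q with h | h
    · have k2 := key (q - lam (min r s + 1 - i)) (by omega) (by omega)
      omega
    · omega

end JordanType

/-- relations among the Jordan types of `(R,S)`, `(q-R,q-S)`, `(q-R,S)`,
`(R,q-S)` where `q = p^n`. -/
theorem stmt8 (p : ℕ) (hp : p.Prime) (F : Type*) [Field F] [CharP F p]
    (n q R S : ℕ) (hn : 0 < n) (hq : q = p ^ n)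
    (hR0 : 0 < R) (hRq : R < q) (hS0 : 0 < S) (hSq : S < q)
    (lam1 lam2 lam3 lam4 : ℕ → ℕ)
    (h1 : IsJordanType F R S lam1)
    (h2 : IsJordanType F (q - R) (q - S) lam2)
    (h3 : IsJordanType F (q - R) S lam3)
    (h4 : IsJordanType F R (q - S) lam4) :
    -- (1)  (here `R + S - q` is `max(e,0)` and `q - (R+S)` is `max(-e,0)`,
    --       `S - R` is `max(f,0)` and `R - S` is `max(-f,0)`, in ℕ)
    ((∀ i, 1 ≤ i → i ≤ R + S - q → lam1 i = q) ∧
      (R + S - q < min R S → lam1 (R + S - q + 1) < q)) ∧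
    -- (2)
    ((∀ i, 1 ≤ i → i ≤ q - (R + S) → lam2 i = q) ∧
      (∀ i, 1 ≤ i → i ≤ min R S - (R + S - q) →
        lam2 (q - (R + S) + i) = lam1 (R + S - q + i))) ∧
    -- (3)
    ((∀ i, 1 ≤ i → i ≤ S - R → lam3 i = q) ∧
      (∀ i, 1 ≤ i → i ≤ min R S - (R + S - q) →
        (lam3 (S - R + i) : ℤ) = (q : ℤ) - lam1 (min R S + 1 - i))) ∧
    -- (4)
    ((∀ i, 1 ≤ i → i ≤ R - S → lam4 i = q) ∧
      (∀ i, 1 ≤ i → i ≤ min R S - (R + S - q) →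
        (lam4 (R - S + i) : ℤ) = (q : ℤ) - lam1 (min R S + 1 - i))) := by
  subst hq
  obtain ⟨h3a, h3b⟩ := h1.reflect hp hRq hS0 hSq h3
  obtain ⟨h4a, h4b⟩ := h1.swap.reflect hp hSq hR0 hRq h4.swap
  obtain ⟨h2a, h2b⟩ := h4.reflect hp hRq (by omega) (by omega) h2
  have h1' : IsJordanType F (p ^ n - (p ^ n - R)) S lam1 := by
    rwa [Nat.sub_sub_self hRq.le]
  obtain ⟨h1a, -⟩ := h3.reflect hp (by omega) hS0 hSq h1'
  rw [min_comm] at h4b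
  refine ⟨⟨fun i hi hi' => h1a i hi (by omega), fun h => ?_⟩,
    ⟨fun i hi hi' => h2a i hi (by omega), fun i hi hi' => ?_⟩,
    ⟨h3a, fun i hi hi' => ?_⟩, ⟨h4a, fun i hi hi' => ?_⟩⟩
  · have e1 := h3b (min R S - (R + S - p ^ n)) (by omega) le_rfl
    have e2 := h3.1 (S - R + (min R S - (R + S - p ^ n))) (by omega) (by omega)
    have e3 : min R S + 1 - (min R S - (R + S - p ^ n)) = R + S - p ^ n + 1 := by omega
    rw [e3] at e1
    omega
  · have e1 := h2b i hi (by omega)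
    have e2 := h4b (min R (p ^ n - S) + 1 - i - (R - S)) (by omega) (by omega)
    have i1 : p ^ n - S - R + i = p ^ n - (R + S) + i := by omega
    have i2 : R - S + (min R (p ^ n - S) + 1 - i - (R - S)) = min R (p ^ n - S) + 1 - i := by
      omega
    have i3 : min R S + 1 - (min R (p ^ n - S) + 1 - i - (R - S)) = R + S - p ^ n + i := by
      omega
    rw [i1] at e1
    rw [i2, i3] at e2
    omega
  · have := h3b i hi hi'
    omega
  · have := h4b i hi (by omega)
    omega
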